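/- For every metric Peano continuum X, S-Dim(X) ≤ HöDim(X) ≤ 2·S-Dim(X), where S-Dim(X) = limsup_{ε→0} ln(S_X(ε))/ln(1/ε) and HöDim(X) = inf{α ∈ (0,∞] : there exists a surjective (1/α)-Hölder map f : [0,1] → X}. -/

import Mathlib

open Set Metric Filter Topology

noncomputable def SX (X : Type*) [MetricSpace X] (ε : ℝ) : ℕ :=
  sInf {n : ℕ | ∃ 𝒞 : Finset (Set X), 𝒞.card = n ∧
    (∀ S ∈ 𝒞, IsConnected S ∧ Metric.diam S ≤ ε) ∧ ⋃₀ (𝒞 : Set (Set X)) = Set.univ}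

/-- The S-dimension `limsup_{ε→0} ln S_X(ε) / ln(1/ε)`. -/
noncomputable def SDim (X : Type*) [MetricSpace X] : ENNReal :=
  Filter.limsup (fun ε : ℝ => ENNReal.ofReal (Real.log (SX X ε) / Real.log (1 / ε)))
    (nhdsWithin 0 (Set.Ioi 0))

/-- The Hölder dimension: the infimum of `α ∈ (0,∞]` for which there exists a surjective
`(1/α)`-Hölder map `[0,1] → X`. -/
noncomputable def HoDim (X : Type*) [MetricSpace X] : ENNReal :=
  sInf {α : ENNReal | 0 < α ∧ ∃ f : ℝ → X, f '' (Set.Icc 0 1) = Set.univ ∧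
    ∃ C : ℝ, 0 < C ∧ ∀ x ∈ Set.Icc (0:ℝ) 1, ∀ y ∈ Set.Icc (0:ℝ) 1,
      dist (f x) (f y) ≤ C * |x - y| ^ (α⁻¹.toReal)}

theorem List.exists_sublist_isChain_nodup {α β : Type*} {R : β → β → Prop} (g : α → β)
    (L : List α) (hL : (L.map g).IsChain R) :
    ∃ L' : List α, L'.Sublist L ∧ (L'.map g).IsChain R ∧ (L'.map g).Nodup ∧
      (L'.map g).head? = (L.map g).head? ∧ (L'.map g).getLast? = (L.map g).getLast? := by
  induction L with
  | nil => exact ⟨[], by simp⟩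
  | cons a L ih =>
    rw [List.map_cons, List.isChain_cons] at hL
    obtain ⟨L', hs, hc, hn, hh, hl⟩ := ih hL.2
    by_cases ha : g a ∈ L'.map g
    · obtain ⟨b, hb, hba⟩ := List.mem_map.1 ha
      obtain ⟨L₁, L₂, rfl⟩ := List.append_of_mem hb
      have hsuf : (b :: L₂) <:+ (L₁ ++ b :: L₂) := List.suffix_append _ _
      refine ⟨b :: L₂, (hsuf.sublist.trans hs).cons a, hc.suffix (hsuf.map g),
        hn.sublist (hsuf.sublist.map g), by simp [hba], ?_⟩
      rw [List.map_cons (l := L), List.getLast?_cons, ← hl]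
      simp [List.getLast?_append, List.getLast?_cons]
    · refine ⟨a :: L', hs.cons_cons a, ?_, ?_, by simp, ?_⟩
      · rw [List.map_cons, List.isChain_cons, hh]
        exact ⟨hL.1, hc⟩
      · rw [List.map_cons, List.nodup_cons]
        exact ⟨ha, hn⟩
      · rw [List.map_cons, List.map_cons, List.getLast?_cons, List.getLast?_cons, hl]

theorem List.exists_sublist_isChain_length_le {α β : Type*} [DecidableEq β] {R : β → β → Prop}
    (g : α → β) (D : Finset β) (n : ℕ) (F : Finset β) (hF : F.card = n) (L : List α)
    (hL : (L.map g).IsChain R) (hD : ∀ a ∈ L, g a ∈ D) (hFL : ∀ b ∈ F, b ∈ L.map g) :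
    ∃ L' : List α, L'.Sublist L ∧ (L'.map g).IsChain R ∧ (∀ b ∈ F, b ∈ L'.map g) ∧
      (L'.map g).head? = (L.map g).head? ∧ L'.length ≤ (n + 1) * D.card := by
  have key : ∀ L : List α, (L.map g).IsChain R → (∀ a ∈ L, g a ∈ D) →
      ∃ L' : List α, L'.Sublist L ∧ (L'.map g).IsChain R ∧
        (L'.map g).head? = (L.map g).head? ∧ (L'.map g).getLast? = (L.map g).getLast? ∧
        L'.length ≤ D.card := by
    intro L hL hD
    obtain ⟨L', hs, hc, hn, hh, hl⟩ := List.exists_sublist_isChain_nodup g L hL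
    refine ⟨L', hs, hc, hh, hl, ?_⟩
    rw [← List.length_map (f := g), ← List.toFinset_card_of_nodup hn]
    refine Finset.card_le_card fun b hb => ?_
    obtain ⟨a, ha, rfl⟩ := List.mem_map.1 (List.mem_toFinset.1 hb)
    exact hD a (hs.subset ha)
  induction n generalizing F L with
  | zero =>
    obtain ⟨L', hs, hc, hh, -, hlen⟩ := key L hL hD
    rw [Finset.card_eq_zero] at hF
    exact ⟨L', hs, hc, by simp [hF], hh, by simpa using hlen⟩
  | succ n ih =>
    have hne : (L.find? (fun a => decide (g a ∈ F))).isSome := by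
      rw [List.find?_isSome]
      obtain ⟨b, hb⟩ := Finset.card_pos.1 (by omega : 0 < F.card)
      obtain ⟨a, ha, rfl⟩ := List.mem_map.1 (hFL b hb)
      exact ⟨a, ha, by simpa using hb⟩
    obtain ⟨x, hx⟩ := Option.isSome_iff_exists.1 hne
    obtain ⟨hxF, as, bs, rfl, has⟩ := List.find?_eq_some_iff_append.1 hx
    replace hxF : g x ∈ F := by simpa using hxF
    replace has : ∀ a ∈ as, g a ∉ F := by simpa using has
    rw [List.map_append, List.isChain_append] at hL
    obtain ⟨L₂, hs₂, hc₂, hF₂, hh₂, hlen₂⟩ := ih (F.erase (g x))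
      (by rw [Finset.card_erase_of_mem hxF]; omega) (x :: bs) hL.2.1
      (fun a ha => hD a (List.mem_append_right _ ha)) (by
        intro b hb
        have h := hFL b (Finset.mem_of_mem_erase hb)
        rw [List.map_append, List.mem_append] at h
        refine h.resolve_left fun h => ?_
        obtain ⟨a, ha, rfl⟩ := List.mem_map.1 h
        exact has a ha (Finset.mem_of_mem_erase hb))
    obtain ⟨L₁, hs₁, hc₁, hh₁, hl₁, hlen₁⟩ := key as hL.1
      (fun a ha => hD a (List.mem_append_left _ ha))
    refine ⟨L₁ ++ L₂, hs₁.append hs₂, ?_, ?_, ?_, ?_⟩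
    · rw [List.map_append, List.isChain_append, hl₁, hh₂]
      exact ⟨hc₁, hc₂, hL.2.2⟩
    · intro b hb
      rw [List.map_append, List.mem_append]
      right
      by_cases hbx : b = g x
      · subst hbx
        have : (L₂.map g).head? = some (g x) := by simpa using hh₂
        exact List.mem_of_head? this
      · exact hF₂ b (Finset.mem_erase.2 ⟨hbx, hb⟩)
    · rw [List.map_append, List.map_append, List.head?_append, List.head?_append, hh₁, hh₂]
    · rw [List.length_append]
      nlinarith

/-- A list that starts at `a`, ends at `b`, and whose consecutive entries are related by `R`. -/
def List.IsWalk {α : Type*} (R : α → α → Prop) (L : List α) (a b : α) : Prop :=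
  L.IsChain R ∧ L.head? = some a ∧ L.getLast? = some b

theorem List.IsWalk.append {α : Type*} {R : α → α → Prop} {L L' : List α} {a b c d : α}
    (h : L.IsWalk R a b) (h' : L'.IsWalk R c d) (hbc : R b c) : (L ++ L').IsWalk R a d := by
  refine ⟨h.1.append h'.1 ?_, by simp [List.head?_append, h.2.1],
    by simp [List.getLast?_append, h'.2.2]⟩
  simpa [h.2.2, h'.2.1] using hbc

theorem List.isWalk_singleton {α : Type*} {R : α → α → Prop} (a : α) : [a].IsWalk R a a := by
  simp [List.IsWalk]

/-- Two sets are related if they intersect. -/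
def Meets {X : Type*} (S T : Set X) : Prop := (S ∩ T).Nonempty

theorem exists_isWalk_of_isPreconnected {X : Type*} [TopologicalSpace X] {A : Set X}
    (hA : IsPreconnected A) (D : Finset (Set X)) (hcl : ∀ S ∈ D, IsClosed S)
    (hcov : ⋃₀ (D : Set (Set X)) = univ) {B B' : Set X} (hB : B ∈ D) (hBA : Meets A B)
    (hB' : B' ∈ D) (hBA' : Meets A B') :
    ∃ L : List (Set X), L.IsWalk Meets B B' ∧ ∀ S ∈ L, S ∈ D ∧ Meets A S := by
  classical
  set P : Set X → Prop := fun C => ∃ L : List (Set X), L.IsWalk Meets B C ∧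
    ∀ S ∈ L, S ∈ D ∧ Meets A S with hP
  by_contra hcon
  let D₁ := D.filter fun S => Meets A S ∧ P S
  let D₂ := D.filter fun S => ¬ (Meets A S ∧ P S)
  have hD₁ : IsClosed (⋃ S ∈ D₁, S) :=
    D₁.finite_toSet.isClosed_biUnion fun S hS => hcl S (Finset.mem_filter.1 hS).1
  have hD₂ : IsClosed (⋃ S ∈ D₂, S) :=
    D₂.finite_toSet.isClosed_biUnion fun S hS => hcl S (Finset.mem_filter.1 hS).1
  have hPB : P B := ⟨[B], List.isWalk_singleton B, by simpa using ⟨hB, hBA⟩⟩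
  obtain ⟨z, hzA, hz₁, hz₂⟩ := isPreconnected_closed_iff.1 hA _ _ hD₁ hD₂ (by
      intro x _
      obtain ⟨S, hS, hxS⟩ := mem_sUnion.1 (hcov.symm ▸ mem_univ x : x ∈ ⋃₀ (D : Set (Set X)))
      by_cases h : Meets A S ∧ P S
      · exact Or.inl (mem_iUnion₂.2 ⟨S, Finset.mem_filter.2 ⟨hS, h⟩, hxS⟩)
      · exact Or.inr (mem_iUnion₂.2 ⟨S, Finset.mem_filter.2 ⟨hS, h⟩, hxS⟩))
    (by
      obtain ⟨x, hxA, hxB⟩ := hBA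
      exact ⟨x, hxA, mem_iUnion₂.2 ⟨B, Finset.mem_filter.2 ⟨hB, ⟨x, hxA, hxB⟩, hPB⟩, hxB⟩⟩)
    (by
      obtain ⟨x, hxA, hxB⟩ := hBA'
      exact ⟨x, hxA, mem_iUnion₂.2 ⟨B', Finset.mem_filter.2 ⟨hB', fun h => hcon h.2⟩, hxB⟩⟩)
  obtain ⟨S, hS, hzS⟩ := mem_iUnion₂.1 hz₁
  obtain ⟨T, hT, hzT⟩ := mem_iUnion₂.1 hz₂
  obtain ⟨-, -, L, hL, hLD⟩ := Finset.mem_filter.1 hS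
  obtain ⟨hTD, hT⟩ := Finset.mem_filter.1 hT
  refine hT ⟨⟨z, hzA, hzT⟩, L ++ [T], hL.append (List.isWalk_singleton T) ⟨z, hzS, hzT⟩, ?_⟩
  intro U hU
  rcases List.mem_append.1 hU with hU | hU
  · exact hLD U hU
  · rw [List.mem_singleton.1 hU]
    exact ⟨hTD, z, hzA, hzT⟩

theorem exists_isWalk_forall_mem {X : Type*} [TopologicalSpace X] {A : Set X}
    (hA : IsPreconnected A) (D : Finset (Set X)) (hcl : ∀ S ∈ D, IsClosed S)
    (hcov : ⋃₀ (D : Set (Set X)) = univ) {B B' : Set X} (hB : B ∈ D) (hBA : Meets A B)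
    (hB' : B' ∈ D) (hBA' : Meets A B') :
    ∃ L : List (Set X), L.IsWalk Meets B B' ∧ (∀ S ∈ L, S ∈ D ∧ Meets A S) ∧
      ∀ S ∈ D, Meets A S → S ∈ L := by
  classical
  suffices h : ∀ F ⊆ D, ∃ L : List (Set X), L.IsWalk Meets B B' ∧ (∀ S ∈ L, S ∈ D ∧ Meets A S) ∧
      ∀ S ∈ F, Meets A S → S ∈ L from h D subset_rfl
  intro F
  induction F using Finset.induction_on with
  | empty =>
    intro _
    obtain ⟨L, h₁, h₂⟩ := exists_isWalk_of_isPreconnected hA D hcl hcov hB hBA hB' hBA'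
    exact ⟨L, h₁, h₂, by simp⟩
  | insert C F _ ih =>
    intro hF
    obtain ⟨L, h₁, h₂, h₃⟩ := ih fun x hx => hF (Finset.mem_insert_of_mem hx)
    by_cases hC : Meets A C
    · have hCD : C ∈ D := hF (Finset.mem_insert_self _ _)
      obtain ⟨L₁, hL₁, hL₁'⟩ := exists_isWalk_of_isPreconnected hA D hcl hcov hB hBA hCD hC
      obtain ⟨L₂, hL₂, hL₂'⟩ := exists_isWalk_of_isPreconnected hA D hcl hcov hCD hC hB hBA
      obtain ⟨x, _, hx⟩ := hBA
      obtain ⟨y, _, hy⟩ := hC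
      refine ⟨(L₁ ++ L₂) ++ L, (hL₁.append hL₂ ⟨y, hy, hy⟩).append h₁ ⟨x, hx, hx⟩, ?_, ?_⟩
      · intro S hS
        simp only [List.mem_append] at hS
        rcases hS with (hS | hS) | hS
        exacts [hL₁' S hS, hL₂' S hS, h₂ S hS]
      · intro S hS hAS
        simp only [List.mem_append]
        rcases Finset.mem_insert.1 hS with rfl | hS
        · exact Or.inl (Or.inl (List.mem_of_getLast? hL₁.2.2))
        · exact Or.inr (h₃ S hS hAS)
    · refine ⟨L, h₁, h₂, ?_⟩
      intro S hS hAS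
      rcases Finset.mem_insert.1 hS with rfl | hS
      · exact absurd hAS hC
      · exact h₃ S hS hAS

theorem exists_refining_list {X : Type*} [TopologicalSpace X] (D : Finset (Set X))
    (hcl : ∀ S ∈ D, IsClosed S) (hcov : ⋃₀ (D : Set (Set X)) = univ) (w : ℕ → Set X) (n : ℕ)
    (hw : ∀ i ≤ n, IsPreconnected (w i)) (hm : ∀ i < n, Meets (w i) (w (i + 1)))
    {B : Set X} (hB : B ∈ D) (hwB : Meets (w n) B) :
    ∃ E : List (Set X × ℕ), (E.map Prod.fst).IsChain Meets ∧
      E.Pairwise (fun a b => a.2 ≤ b.2) ∧ (∀ e ∈ E, e.1 ∈ D ∧ e.2 ≤ n ∧ Meets (w e.2) e.1) ∧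
      (∀ i ≤ n, ∀ S ∈ D, Meets (w i) S → S ∈ E.map Prod.fst) ∧
      (E.map Prod.fst).getLast? = some B := by
  induction n generalizing B with
  | zero =>
    obtain ⟨L, h₁, h₂, h₃⟩ :=
      exists_isWalk_forall_mem (hw 0 le_rfl) D hcl hcov hB hwB hB hwB
    have hmap : (L.map fun S => (S, 0)).map Prod.fst = L := by simp [Function.comp_def]
    refine ⟨L.map fun S => (S, 0), ?_, ?_, ?_, ?_, ?_⟩
    · rw [hmap]; exact h₁.1
    · exact List.pairwise_map.2 (List.pairwise_of_forall fun _ _ => le_rfl)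
    · intro e he
      obtain ⟨S, hS, rfl⟩ := List.mem_map.1 he
      exact ⟨(h₂ S hS).1, le_rfl, (h₂ S hS).2⟩
    · intro i hi S hS hwS
      obtain rfl : i = 0 := by omega
      rw [hmap]; exact h₃ S hS hwS
    · rw [hmap]; exact h₁.2.2
  | succ n ih =>
    obtain ⟨z, hz, hz'⟩ := hm n (Nat.lt_succ_self n)
    obtain ⟨B₀, hB₀, hzB₀⟩ := mem_sUnion.1 (hcov.symm ▸ mem_univ z : z ∈ ⋃₀ (D : Set (Set X)))
    obtain ⟨E, hE₁, hE₂, hE₃, hE₄, hE₅⟩ := ih (fun i hi => hw i (by omega))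
      (fun i hi => hm i (by omega)) hB₀ ⟨z, hz, hzB₀⟩
    obtain ⟨L, h₁, h₂, h₃⟩ :=
      exists_isWalk_forall_mem (hw (n + 1) le_rfl) D hcl hcov hB₀ ⟨z, hz', hzB₀⟩ hB hwB
    have hmap : (L.map fun S => (S, n + 1)).map Prod.fst = L := by simp [Function.comp_def]
    refine ⟨E ++ L.map fun S => (S, n + 1), ?_, ?_, ?_, ?_, ?_⟩
    · rw [List.map_append, hmap, List.isChain_append, hE₅, h₁.2.1]
      refine ⟨hE₁, h₁.1, ?_⟩
      have hB₀B₀ : Meets B₀ B₀ := ⟨z, hzB₀, hzB₀⟩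
      simpa only [Option.mem_some_iff, forall_eq'] using hB₀B₀
    · rw [List.pairwise_append]
      refine ⟨hE₂, List.pairwise_map.2 (List.pairwise_of_forall fun _ _ => le_rfl), fun a ha b hb => ?_⟩
      obtain ⟨S, hS, rfl⟩ := List.mem_map.1 hb
      exact (hE₃ a ha).2.1.trans (Nat.le_succ n)
    · intro e he
      rcases List.mem_append.1 he with he | he
      · exact ⟨(hE₃ e he).1, (hE₃ e he).2.1.trans (Nat.le_succ n), (hE₃ e he).2.2⟩
      · obtain ⟨S, hS, rfl⟩ := List.mem_map.1 he
        exact ⟨(h₂ S hS).1, le_rfl, (h₂ S hS).2⟩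
    · intro i hi S hS hwS
      rw [List.map_append, hmap, List.mem_append]
      rcases Nat.le_succ_iff.1 hi with hi | rfl
      · exact Or.inl (hE₄ i hi S hS hwS)
      · exact Or.inr (h₃ S hS hwS)
    · rw [List.map_append, hmap, List.getLast?_append, h₁.2.2]
      rfl

/-- A sequence of finite covers by closed connected sets whose diameters decay geometrically,
starting with the trivial cover. -/
structure IsGeometricCovering {X : Type*} [MetricSpace X] (𝒞 : ℕ → Finset (Set X)) (R : ℝ) :
    Prop where
  zero : 𝒞 0 = {univ}
  isConnected : ∀ m, ∀ S ∈ 𝒞 m, IsConnected S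
  isClosed : ∀ m, ∀ S ∈ 𝒞 m, IsClosed S
  dist_le : ∀ m, ∀ S ∈ 𝒞 m, ∀ x ∈ S, ∀ y ∈ S, dist x y ≤ R * (1 / 2) ^ m
  cover : ∀ m, ⋃₀ (𝒞 m : Set (Set X)) = univ

/-- A walk `w 0, …, w (K - 1)` through all the members of the `m`-th cover. For every `l ≤ m` it
is divided into consecutive blocks, numbered by `τ l`, whose diameters are comparable to those of
the members of the `l`-th cover. -/
structure IsTaggedWalk {X : Type*} [MetricSpace X] (𝒞 : ℕ → Finset (Set X)) (R : ℝ) (m K : ℕ)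
    (w : ℕ → Set X) (τ : ℕ → ℕ → ℕ) : Prop where
  pos : 0 < K
  mem : ∀ i < K, w i ∈ 𝒞 m
  meets : ∀ i, i + 1 < K → Meets (w i) (w (i + 1))
  exists_eq : ∀ S ∈ 𝒞 m, ∃ i < K, w i = S
  mono : ∀ l ≤ m, ∀ i j, i ≤ j → j < K → τ l i ≤ τ l j
  lt : ∀ l ≤ m, ∀ i < K, τ l i < ((𝒞 l).card + 1) * (𝒞 l).card
  dist_le : ∀ l ≤ m, ∀ i < K, ∀ j < K, τ l i = τ l j → ∀ x ∈ w i, ∀ y ∈ w j,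
    dist x y ≤ 3 * R * (1 / 2) ^ l - 2 * R * (1 / 2) ^ m
  self : ∀ i < K, τ m i = i

theorem IsGeometricCovering.exists_isTaggedWalk {X : Type*} [MetricSpace X]
    {𝒞 : ℕ → Finset (Set X)} {R : ℝ} (h : IsGeometricCovering 𝒞 R) (m : ℕ) :
    ∃ K w τ, IsTaggedWalk 𝒞 R m K w τ := by
  classical
  induction m with
  | zero =>
    have h0 : (univ : Set X) ∈ 𝒞 0 := by simp [h.zero]
    refine ⟨1, fun _ => univ, fun _ _ => 0, ?_⟩
    constructor
    · exact one_pos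
    · intro i _; exact h0
    · intro i hi; omega
    · intro S hS
      rw [h.zero, Finset.mem_singleton] at hS
      exact ⟨0, one_pos, hS.symm⟩
    · intros; exact le_rfl
    · intro l hl i _
      obtain rfl : l = 0 := by omega
      simp [h.zero]
    · intro l hl i _ j _ _ x _ y _
      obtain rfl : l = 0 := by omega
      have := h.dist_le 0 _ h0 x (mem_univ x) y (mem_univ y)
      linarith
    · intro i hi; omega
  | succ m ih =>
    obtain ⟨K, w, τ, hw⟩ := ih
    obtain ⟨n, rfl⟩ : ∃ n, K = n + 1 := ⟨K - 1, by have := hw.pos; omega⟩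
    obtain ⟨z, hz⟩ := (h.isConnected m _ (hw.mem n (by omega))).nonempty
    obtain ⟨B, hB, hzB⟩ :=
      mem_sUnion.1 (h.cover (m + 1) ▸ mem_univ z : z ∈ ⋃₀ (𝒞 (m + 1) : Set (Set X)))
    obtain ⟨E, hE₁, hE₂, hE₃, hE₄, hE₅⟩ := exists_refining_list (𝒞 (m + 1)) (h.isClosed _)
      (h.cover _) w n (fun i hi => (h.isConnected m _ (hw.mem i (by omega))).isPreconnected)
      (fun i hi => hw.meets i (by omega)) hB ⟨z, hz, hzB⟩
    have hall : ∀ S ∈ 𝒞 (m + 1), S ∈ E.map Prod.fst := by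
      intro S hS
      obtain ⟨x, hx⟩ := (h.isConnected (m + 1) _ hS).nonempty
      obtain ⟨A, hA, hxA⟩ := mem_sUnion.1 (h.cover m ▸ mem_univ x : x ∈ ⋃₀ (𝒞 m : Set (Set X)))
      obtain ⟨i, hi, rfl⟩ := hw.exists_eq A hA
      exact hE₄ i (by omega) S hS ⟨x, hxA, hx⟩
    obtain ⟨L, hLE, hLc, hLall, -, hLlen⟩ := List.exists_sublist_isChain_length_le Prod.fst
      (𝒞 (m + 1)) _ (𝒞 (m + 1)) rfl E hE₁ (fun e he => (hE₃ e he).1) hall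
    have hLp := hE₂.sublist hLE
    set v : ℕ → Set X × ℕ := fun i => L.getD i (∅, 0) with hv
    have hvi : ∀ i (hi : i < L.length), v i = L[i] := fun i hi => by simp [hv, hi]
    have hvE : ∀ i < L.length, v i ∈ E := fun i hi => by
      rw [hvi i hi]; exact hLE.subset (List.getElem_mem hi)
    have hvp : ∀ i j, i ≤ j → j < L.length → (v i).2 ≤ (v j).2 := by
      intro i j hij hj
      rcases hij.eq_or_lt with rfl | hij
      · exact le_rfl
      · rw [hvi i (hij.trans hj), hvi j hj]
        exact List.pairwise_iff_getElem.1 hLp i j _ hj hij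
    have hex : ∀ S ∈ 𝒞 (m + 1), ∃ i < L.length, (v i).1 = S := by
      intro S hS
      obtain ⟨e, he, rfl⟩ := List.mem_map.1 (hLall S hS)
      obtain ⟨i, hi, rfl⟩ := List.getElem_of_mem he
      exact ⟨i, hi, by rw [hvi i hi]⟩
    have hlt : ∀ i < L.length, (v i).2 < n + 1 := fun i hi => by
      have := (hE₃ _ (hvE i hi)).2.1; omega
    have hmeet : ∀ i < L.length, Meets (w (v i).2) (v i).1 :=
      fun i hi => (hE₃ _ (hvE i hi)).2.2
    have hmem : ∀ i < L.length, (v i).1 ∈ 𝒞 (m + 1) := fun i hi => (hE₃ _ (hvE i hi)).1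
    refine ⟨L.length, fun i => (v i).1, fun l i => if l = m + 1 then i else τ l (v i).2, ?_⟩
    have hpow : (1 / 2 : ℝ) ^ (m + 1) = (1 / 2) ^ m / 2 := by rw [pow_succ]; ring
    constructor
    · obtain ⟨i, hi, -⟩ := hex B hB
      omega
    · exact hmem
    · intro i hi
      have := List.isChain_iff_getElem.1 hLc i (by simpa using hi)
      rw [List.getElem_map, List.getElem_map] at this
      show Meets (v i).1 (v (i + 1)).1
      rw [hvi i (by omega), hvi _ hi]
      exact this
    · exact hex
    · intro l hl i j hij hj
      by_cases hlm : l = m + 1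
      · simpa [hlm] using hij
      · simpa [hlm] using hw.mono l (by omega) _ _ (hvp i j hij hj) (hlt j hj)
    · intro l hl i hi
      by_cases hlm : l = m + 1
      · subst hlm
        simpa using hi.trans_le hLlen
      · simpa [hlm] using hw.lt l (by omega) _ (hlt i hi)
    · intro l hl i hi j hj hij x hx y hy
      by_cases hlm : l = m + 1
      · simp only [hlm, if_true] at hij
        subst hij hlm
        have := h.dist_le _ _ (hmem i hi) x hx y hy
        linarith
      · simp only [hlm, if_false] at hij
        obtain ⟨x', hxw, hx'⟩ := hmeet i hi
        obtain ⟨y', hyw, hy'⟩ := hmeet j hj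
        have h₁ := h.dist_le _ _ (hmem i hi) x hx x' hx'
        have h₂ := h.dist_le _ _ (hmem j hj) y' hy' y hy
        have h₃ := hw.dist_le l (by omega) _ (hlt i hi) _ (hlt j hj) hij x' hxw y' hyw
        have h₄ := dist_triangle4 x x' y' y
        rw [hpow] at h₁ h₂ ⊢
        linarith
    · intro i hi
      simp

theorem exists_step_map {X : Type*} [MetricSpace X] {K : ℕ} (hK : 0 < K) (x : ℕ → X)
    (φ : ℕ → ℝ) {T p η : ℝ} (hT : 0 < T) (hp : 0 < p) (hη : 0 ≤ η)
    (hφT : ∀ i < K, φ i ∈ Icc 0 T)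
    (hφ : ∀ i j, i ≤ j → j < K → dist (x i) (x j) ^ p ≤ φ j - φ i)
    (hadj : ∀ i, i + 1 < K → dist (x i) (x (i + 1)) ≤ η)
    (hdense : ∀ y, ∃ i < K, dist (x i) y ≤ η) :
    ∃ g : ℝ → X, (∀ s t, s ≤ t → dist (g s) (g t) ≤ η + (T * (t - s)) ^ (1 / p)) ∧
      ∀ y, ∃ t ∈ Icc (0 : ℝ) 1, dist (g t) y ≤ η := by
  classical
  set J : ℝ → ℕ := fun t => Nat.findGreatest (fun i => φ i ≤ T * t) (K - 1) with hJ
  have hJK : ∀ t, J t < K := fun t => by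
    have : J t ≤ K - 1 := Nat.findGreatest_le _
    omega
  have hJφ : ∀ t, J t ≠ 0 → φ (J t) ≤ T * t := fun t h =>
    Nat.findGreatest_of_ne_zero (P := fun i => φ i ≤ T * t) rfl h
  refine ⟨fun t => x (J t), fun s t hst => ?_, fun y => ?_⟩
  · have hpow : 0 ≤ (T * (t - s)) ^ (1 / p) :=
      Real.rpow_nonneg (mul_nonneg hT.le (sub_nonneg.2 hst)) _
    rcases le_or_gt (J t) (J s) with hle | hlt
    · have hle' : J s ≤ J t := by
        by_cases h0 : J s = 0
        · omega
        · exact Nat.le_findGreatest (by have := hJK s; omega)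
            ((hJφ s h0).trans (mul_le_mul_of_nonneg_left hst hT.le))
      simp only [le_antisymm hle hle', dist_self]
      positivity
    · have h₁ : ¬ φ (J s + 1) ≤ T * s :=
        Nat.findGreatest_is_greatest (P := fun i => φ i ≤ T * s) (n := K - 1)
          (Nat.lt_succ_self _) (by have := hJK t; omega)
      have h₂ := hJφ t (by omega)
      have h₃ := hφ (J s + 1) (J t) hlt (hJK t)
      have h₄ : dist (x (J s + 1)) (x (J t)) ≤ (T * (t - s)) ^ (1 / p) := by
        rw [one_div, Real.le_rpow_inv_iff_of_pos dist_nonneg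
          (mul_nonneg hT.le (sub_nonneg.2 hst)) hp]
        linarith
      have h₅ := hadj (J s) (by have := hJK t; omega)
      have h₆ := dist_triangle (x (J s)) (x (J s + 1)) (x (J t))
      show dist (x (J s)) (x (J t)) ≤ _
      linarith
  · obtain ⟨i, hi, hiy⟩ := hdense y
    have hTt : T * (φ i / T) = φ i := by field_simp
    refine ⟨φ i / T, ⟨div_nonneg (hφT i hi).1 hT.le, (div_le_one hT).2 (hφT i hi).2⟩, ?_⟩
    have hle : i ≤ J (φ i / T) := Nat.le_findGreatest (by omega) hTt.ge
    suffices h : x (J (φ i / T)) = x i by simpa only [h] using hiy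
    by_cases h0 : J (φ i / T) = 0
    · rw [h0, show i = 0 by omega]
    · have h₁ := hJφ _ h0
      rw [hTt] at h₁
      have h₂ := hφ i _ hle (hJK (φ i / T))
      by_contra hne
      have := Real.rpow_pos_of_pos (dist_pos.2 (Ne.symm hne)) p
      linarith

theorem exists_holder_surjection_of_approx {X : Type*} [MetricSpace X] [CompactSpace X]
    {T p : ℝ} (hT : 0 < T) (hp : 0 < p) {η : ℕ → ℝ} (hη : Tendsto η atTop (𝓝 0))
    (happrox : ∀ m, ∃ g : ℝ → X,
      (∀ s t, s ≤ t → dist (g s) (g t) ≤ η m + (T * (t - s)) ^ (1 / p)) ∧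
      ∀ y, ∃ t ∈ Icc (0 : ℝ) 1, dist (g t) y ≤ η m) :
    ∃ f : ℝ → X, f '' Icc 0 1 = univ ∧
      ∀ s t, dist (f s) (f t) ≤ T ^ (1 / p) * |s - t| ^ (1 / p) := by
  choose g hg hdense using happrox
  let U : Ultrafilter ℕ := Filter.hyperfilter ℕ
  have hU : (U : Filter ℕ) ≤ atTop := Nat.hyperfilter_le_atTop
  have hηU : Tendsto η U (𝓝 0) := hη.mono_left hU
  have hlim : ∀ t, ∃ z, Tendsto (fun m => g m t) U (𝓝 z) := fun t =>
    ⟨_, (U.map fun m => g m t).le_nhds_lim⟩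
  choose f hf using hlim
  have hg' : ∀ m s t, dist (g m s) (g m t) ≤ η m + T ^ (1 / p) * |s - t| ^ (1 / p) := by
    intro m s t
    rw [← Real.mul_rpow hT.le (abs_nonneg _)]
    rcases le_total s t with h | h
    · rw [abs_sub_comm, abs_of_nonneg (sub_nonneg.2 h)]
      exact hg m s t h
    · rw [abs_of_nonneg (sub_nonneg.2 h), dist_comm]
      exact hg m t s h
  refine ⟨f, ?_, fun s t => ?_⟩
  · refine eq_univ_of_forall fun y => ?_
    choose t ht hty using fun m => hdense m y
    obtain ⟨t₀, ht₀, hlim⟩ := (isCompact_Icc (a := (0 : ℝ)) (b := 1)).ultrafilter_le_nhds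
      (U.map t) (by
        rw [le_principal_iff]
        exact Filter.Eventually.of_forall (f := (U : Filter ℕ)) ht)
    have hlim' : Tendsto t U (𝓝 t₀) := hlim
    refine ⟨t₀, ht₀, ?_⟩
    have h₁ : Tendsto (fun m => (η m + T ^ (1 / p) * |t₀ - t m| ^ (1 / p)) + η m) U
        (𝓝 ((0 + T ^ (1 / p) * |t₀ - t₀| ^ (1 / p)) + 0)) := by
      refine (hηU.add (Tendsto.const_mul _ ?_)).add hηU
      exact ((tendsto_const_nhds.sub hlim').abs).rpow_const (Or.inr (by positivity))
    have h₂ : dist (f t₀) y ≤ (0 + T ^ (1 / p) * |t₀ - t₀| ^ (1 / p)) + 0 :=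
      le_of_tendsto_of_tendsto' ((hf t₀).dist tendsto_const_nhds) h₁ fun m =>
        (dist_triangle _ (g m (t m)) _).trans (add_le_add (hg' m _ _) (hty m))
    rw [sub_self, abs_zero, Real.zero_rpow (by positivity)] at h₂
    exact dist_le_zero.1 (by simpa using h₂)
  · have h := le_of_tendsto_of_tendsto' ((hf s).dist (hf t)) (hηU.add_const _)
      fun m => hg' m s t
    simpa using h

theorem IsGeometricCovering.exists_holder_surjection {X : Type*} [MetricSpace X] [CompactSpace X]
    {𝒞 : ℕ → Finset (Set X)} {R : ℝ} (h : IsGeometricCovering 𝒞 R) (hR : 0 < R) {c t p : ℝ}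
    (hp : 0 < p) (htp : 2 * t < p) (hc : 0 < c)
    (hcard : ∀ m, ((𝒞 m).card : ℝ) ≤ c * ((2 : ℝ) ^ t) ^ m) :
    ∃ f : ℝ → X, f '' Icc 0 1 = univ ∧
      ∃ C : ℝ, 0 < C ∧ ∀ s t, dist (f s) (f t) ≤ C * |s - t| ^ (1 / p) := by
  set q : ℝ := (1 / 2) ^ p * ((2 : ℝ) ^ t) ^ 2 with hq
  have hq0 : 0 ≤ q := by positivity
  have hq1 : q < 1 := by
    rw [hq, one_div, Real.inv_rpow zero_le_two, ← Real.rpow_natCast, ← Real.rpow_mul zero_le_two,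
      inv_mul_lt_one₀ (by positivity)]
    exact Real.rpow_lt_rpow_of_exponent_lt one_lt_two (by push_cast; linarith)
  set c' : ℝ := (6 * R) ^ p * (2 * c ^ 2) with hc'
  have hc₀ : 0 < c' := by positivity
  have hsum : Summable fun l : ℕ => c' * q ^ l := (summable_geometric_of_lt_one hq0 hq1).mul_left _
  set T : ℝ := (∑' l : ℕ, c' * q ^ l) + 1 with hTdef
  have hT : 0 < T := by
    have : 0 ≤ ∑' l : ℕ, c' * q ^ l := tsum_nonneg fun l => by positivity
    linarith
  set a : ℕ → ℝ := fun l => (6 * R * (1 / 2) ^ l) ^ p with ha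
  have ha0 : ∀ l, 0 ≤ a l := fun l => by positivity
  have haq : ∀ l n : ℕ, n < ((𝒞 l).card + 1) * (𝒞 l).card → a l * n ≤ c' * q ^ l := by
    intro l n hn
    have h₁ : a l = (6 * R) ^ p * ((1 / 2) ^ p) ^ l := by
      rw [ha]
      show (6 * R * (1 / 2) ^ l) ^ p = _
      rw [Real.mul_rpow (by positivity) (by positivity), ← Real.rpow_natCast, ← Real.rpow_mul
        (by positivity), mul_comm (l : ℝ) p, Real.rpow_mul (by positivity), Real.rpow_natCast]
    have h₂ : (n : ℝ) ≤ 2 * (c * ((2 : ℝ) ^ t) ^ l) ^ 2 := by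
      have h₃ : n ≤ 2 * (𝒞 l).card ^ 2 := by
        rcases Nat.eq_zero_or_pos (𝒞 l).card with h0 | h0
        · simp [h0] at hn
        · nlinarith
      calc (n : ℝ) ≤ 2 * ((𝒞 l).card : ℝ) ^ 2 := by exact_mod_cast h₃
        _ ≤ _ := by
          gcongr
          exact hcard l
    calc a l * n ≤ a l * (2 * (c * ((2 : ℝ) ^ t) ^ l) ^ 2) := by
          exact mul_le_mul_of_nonneg_left h₂ (ha0 l)
      _ = c' * q ^ l := by
          rw [h₁, hc', hq, mul_pow, mul_pow, ← pow_mul, ← pow_mul, mul_comm l 2]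
          ring
  have hη : Tendsto (fun m : ℕ => 2 * R * (1 / 2 : ℝ) ^ m) atTop (𝓝 0) := by
    simpa using (tendsto_pow_atTop_nhds_zero_of_lt_one (by norm_num : (0 : ℝ) ≤ 1 / 2)
      (by norm_num)).const_mul (2 * R)
  obtain ⟨f, hf, hfd⟩ := exists_holder_surjection_of_approx hT hp hη (X := X) (by
    intro m
    obtain ⟨K, w, τ, hw⟩ := h.exists_isTaggedWalk m
    have hne : ∀ i, ∃ x, i < K → x ∈ w i := fun i => by
      by_cases hi : i < K
      · obtain ⟨x, hx⟩ := (h.isConnected m _ (hw.mem i hi)).nonempty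
        exact ⟨x, fun _ => hx⟩
      · obtain ⟨x, -⟩ := (h.isConnected m _ (hw.mem 0 hw.pos)).nonempty
        exact ⟨x, fun h => absurd h hi⟩
    choose x hx using hne
    refine exists_step_map hw.pos x (fun i => ∑ l ∈ Finset.range (m + 1), a l * τ l i) hT hp
      (by positivity) ?_ ?_ ?_ ?_
    · intro i hi
      refine ⟨Finset.sum_nonneg fun l _ => mul_nonneg (ha0 l) (Nat.cast_nonneg _), ?_⟩
      calc ∑ l ∈ Finset.range (m + 1), a l * τ l i
          ≤ ∑ l ∈ Finset.range (m + 1), c' * q ^ l := Finset.sum_le_sum fun l hl =>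
            haq l _ (hw.lt l (by have := Finset.mem_range.1 hl; omega) i hi)
        _ ≤ ∑' l : ℕ, c' * q ^ l := hsum.sum_le_tsum _ fun l _ => by positivity
        _ ≤ T := by linarith
    · intro i j hij hj
      have hi : i < K := hij.trans_lt hj
      have hterm : ∀ l ∈ Finset.range (m + 1), 0 ≤ a l * τ l j - a l * τ l i := by
        intro l hl
        have := hw.mono l (by have := Finset.mem_range.1 hl; omega) i j hij hj
        rw [← mul_sub]
        exact mul_nonneg (ha0 l) (sub_nonneg.2 (by exact_mod_cast this))
      rw [← Finset.sum_sub_distrib]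
      rcases hij.eq_or_lt with rfl | hlt
      · rw [dist_self, Real.zero_rpow hp.ne']
        exact Finset.sum_nonneg hterm
      have hex : ∃ l, l ≤ m ∧ τ l i ≠ τ l j :=
        ⟨m, le_rfl, by rw [hw.self i hi, hw.self j hj]; exact hlt.ne⟩
      classical
      obtain ⟨hlm, hl⟩ := Nat.find_spec hex
      have hmin := fun k (hk : k < Nat.find hex) => Nat.find_min hex hk
      generalize Nat.find hex = l at hlm hl hmin
      have hdist : dist (x i) (x j) ≤ 6 * R * (1 / 2) ^ l := by
        rcases l with _ | l
        · have := h.dist_le 0 univ (by simp [h.zero]) (x i) (mem_univ _) (x j) (mem_univ _)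
          simp only [pow_zero, mul_one] at this ⊢
          linarith
        · have heq : τ l i = τ l j := by
            by_contra hne
            exact hmin l (Nat.lt_succ_self l) ⟨by omega, hne⟩
          have := hw.dist_le l (by omega) i hi j hj heq _ (hx i hi) _ (hx j hj)
          have h0 : 0 ≤ 2 * R * (1 / 2) ^ m := by positivity
          rw [pow_succ]
          linarith
      have hτ : (τ l i : ℝ) + 1 ≤ τ l j := by
        exact_mod_cast lt_of_le_of_ne (hw.mono l hlm i j hij hj) hl
      calc dist (x i) (x j) ^ p ≤ a l := Real.rpow_le_rpow dist_nonneg hdist hp.le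
        _ ≤ a l * τ l j - a l * τ l i := by nlinarith [ha0 l]
        _ ≤ _ := Finset.single_le_sum hterm (Finset.mem_range.2 (by omega))
    · intro i hi
      obtain ⟨z, hz, hz'⟩ := hw.meets i hi
      have h₁ := h.dist_le m _ (hw.mem i (by omega)) _ (hx i (by omega)) z hz
      have h₂ := h.dist_le m _ (hw.mem _ hi) z hz' _ (hx _ hi)
      have h₃ := dist_triangle (x i) z (x (i + 1))
      linarith
    · intro y
      obtain ⟨S, hS, hyS⟩ := mem_sUnion.1 (h.cover m ▸ mem_univ y : y ∈ ⋃₀ (𝒞 m : Set (Set X)))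
      obtain ⟨i, hi, rfl⟩ := hw.exists_eq S hS
      have h₁ := h.dist_le m _ hS _ (hx i hi) y hyS
      have h0 : 0 ≤ R * (1 / 2) ^ m := by positivity
      exact ⟨i, hi, by linarith⟩)
  exact ⟨f, hf, T ^ (1 / p), by positivity, hfd⟩

theorem exists_finset_card_eq_SX (X : Type*) [MetricSpace X] [CompactSpace X]
    [LocallyConnectedSpace X] {ε : ℝ} (hε : 0 < ε) :
    ∃ 𝒞 : Finset (Set X), 𝒞.card = SX X ε ∧
      (∀ S ∈ 𝒞, IsConnected S ∧ Metric.diam S ≤ ε) ∧ ⋃₀ (𝒞 : Set (Set X)) = Set.univ := by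
  classical
  have hne : {n : ℕ | ∃ 𝒞 : Finset (Set X), 𝒞.card = n ∧
      (∀ S ∈ 𝒞, IsConnected S ∧ Metric.diam S ≤ ε) ∧
      ⋃₀ (𝒞 : Set (Set X)) = Set.univ}.Nonempty := by
    have hV : ∀ x : X, ∃ V ⊆ ball x (ε / 2), IsOpen V ∧ x ∈ V ∧ IsConnected V := fun x =>
      locallyConnectedSpace_iff_subsets_isOpen_isConnected.1 ‹_› x _
        (ball_mem_nhds x (half_pos hε))
    choose V hVball hVopen hxV hVconn using hV
    obtain ⟨t, -, ht⟩ := isCompact_univ.elim_nhds_subcover V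
      fun x _ => (hVopen x).mem_nhds (hxV x)
    refine ⟨_, t.image V, rfl, ?_, ?_⟩
    · intro S hS
      obtain ⟨x, -, rfl⟩ := Finset.mem_image.1 hS
      refine ⟨hVconn x, diam_le_of_forall_dist_le hε.le fun y hy z hz => ?_⟩
      have h₁ := mem_ball.1 (hVball x hy)
      have h₂ := mem_ball.1 (hVball x hz)
      have h₃ := dist_triangle_right y z x
      linarith
    · refine eq_univ_of_forall fun x => ?_
      obtain ⟨y, hy, hxy⟩ := mem_iUnion₂.1 (ht (mem_univ x))
      exact mem_sUnion.2 ⟨V y, Finset.mem_coe.2 (Finset.mem_image_of_mem V hy), hxy⟩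
  exact Nat.sInf_mem hne

theorem SX_le_card {X : Type*} [MetricSpace X] {ε : ℝ} {𝒞 : Finset (Set X)}
    (h : ∀ S ∈ 𝒞, IsConnected S ∧ Metric.diam S ≤ ε) (hcov : ⋃₀ (𝒞 : Set (Set X)) = univ) :
    SX X ε ≤ 𝒞.card :=
  Nat.sInf_le ⟨𝒞, rfl, h, hcov⟩

theorem SX_le_of_holder {X : Type*} [MetricSpace X] {f : ℝ → X} (hf : f '' Icc 0 1 = univ)
    {C a : ℝ} (hC : 0 < C) (ha : 0 < a)
    (hfC : ∀ x ∈ Icc (0 : ℝ) 1, ∀ y ∈ Icc (0 : ℝ) 1, dist (f x) (f y) ≤ C * |x - y| ^ a⁻¹)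
    {ε : ℝ} (hε : 0 < ε) : SX X ε ≤ ⌈(C / ε) ^ a⌉₊ := by
  classical
  set N := ⌈(C / ε) ^ a⌉₊ with hN
  have hN0 : 0 < N := Nat.ceil_pos.2 (by positivity)
  have hN₁ : (0 : ℝ) < N := by exact_mod_cast hN0
  have hcont : ContinuousOn f (Icc 0 1) := by
    intro x hx
    refine tendsto_iff_dist_tendsto_zero.2 (squeeze_zero' (g := fun y => C * |y - x| ^ a⁻¹)
      (Eventually.of_forall fun _ => dist_nonneg)
      (eventually_nhdsWithin_of_forall fun y hy => hfC y hy x hx) ?_)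
    have : ContinuousAt (fun y : ℝ => C * |y - x| ^ a⁻¹) x := by
      refine continuousAt_const.mul (ContinuousAt.rpow_const ?_ (Or.inr (by positivity)))
      fun_prop
    have h := this.tendsto
    rw [sub_self, abs_zero, Real.zero_rpow (by positivity), mul_zero] at h
    exact h.mono_left nhdsWithin_le_nhds
  have hsub : ∀ k < N, Icc ((k : ℝ) / N) ((k + 1) / N) ⊆ Icc 0 1 := by
    intro k hk
    refine Icc_subset_Icc (by positivity) ((div_le_one hN₁).2 ?_)
    exact_mod_cast hk
  have hsmall : C * (1 / (N : ℝ)) ^ a⁻¹ ≤ ε := by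
    have h₁ : C / ε ≤ (N : ℝ) ^ a⁻¹ :=
      (Real.le_rpow_inv_iff_of_pos (by positivity) hN₁.le ha).2 (Nat.le_ceil _)
    rw [one_div, Real.inv_rpow hN₁.le, ← div_eq_mul_inv, div_le_iff₀ (by positivity)]
    rwa [div_le_iff₀ hε, mul_comm] at h₁
  refine (SX_le_card (𝒞 := (Finset.range N).image
    fun k : ℕ => f '' Icc ((k : ℝ) / N) ((k + 1) / N)) ?_ ?_).trans
    (Finset.card_image_le.trans (Finset.card_range N).le)
  · intro S hS
    obtain ⟨k, hk, rfl⟩ := Finset.mem_image.1 hS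
    have hk' := hsub k (Finset.mem_range.1 hk)
    have hle : (k : ℝ) / N ≤ (k + 1) / N := by gcongr; linarith
    refine ⟨(isConnected_Icc hle).image f (hcont.mono hk'),
      diam_le_of_forall_dist_le hε.le ?_⟩
    rintro _ ⟨x, hx, rfl⟩ _ ⟨y, hy, rfl⟩
    refine (hfC x (hk' hx) y (hk' hy)).trans (le_trans ?_ hsmall)
    have hxy : |x - y| ≤ 1 / N := by
      have := abs_sub_le_of_le_of_le hx.1 hx.2 hy.1 hy.2
      rwa [← sub_div, add_sub_cancel_left] at this
    gcongr
  · refine eq_univ_of_forall fun z => ?_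
    obtain ⟨x, hx, rfl⟩ : z ∈ f '' Icc 0 1 := hf ▸ mem_univ z
    have hex : ∃ k < N, x ∈ Icc ((k : ℝ) / N) ((k + 1) / N) := by
      rcases hx.2.eq_or_lt with rfl | hx1
      · refine ⟨N - 1, by omega, ?_, ?_⟩
        · rw [div_le_one hN₁]
          exact_mod_cast Nat.sub_le N 1
        · rw [le_div_iff₀ hN₁, one_mul]
          exact_mod_cast (by omega : N ≤ N - 1 + 1)
      · have h0 : 0 ≤ x * N := mul_nonneg hx.1 hN₁.le
        refine ⟨⌊x * N⌋₊, (Nat.floor_lt h0).2 (by nlinarith), ?_, ?_⟩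
        · rw [div_le_iff₀ hN₁]
          exact Nat.floor_le h0
        · rw [le_div_iff₀ hN₁]
          exact (Nat.lt_floor_add_one _).le
    obtain ⟨k, hk, hxk⟩ := hex
    exact mem_sUnion.2 ⟨_, Finset.mem_coe.2 (Finset.mem_image_of_mem _ (Finset.mem_range.2 hk)),
      mem_image_of_mem f hxk⟩

theorem SDim_le_HoDim (X : Type*) [MetricSpace X] : SDim X ≤ HoDim X := by
  refine le_sInf ?_
  rintro α ⟨hα, f, hf, C, hC, hfC⟩
  rcases eq_or_ne α ⊤ with rfl | hα'
  · exact le_top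
  set a := α.toReal with ha
  have ha0 : 0 < a := ENNReal.toReal_pos hα.ne' hα'
  rw [ENNReal.toReal_inv] at hfC
  have hinv : Tendsto (fun ε : ℝ => Real.log (1 / ε)) (𝓝[>] 0) atTop := by
    simp only [one_div]
    exact Real.tendsto_log_atTop.comp tendsto_inv_nhdsGT_zero
  have hlim : Tendsto (fun ε : ℝ => ENNReal.ofReal (Real.log (C ^ a + 1) / Real.log (1 / ε) + a))
      (𝓝[>] 0) (𝓝 α) := by
    have h : Tendsto (fun ε : ℝ => Real.log (C ^ a + 1) / Real.log (1 / ε) + a) (𝓝[>] 0)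
        (𝓝 (0 + a)) := (hinv.const_div_atTop _).add_const a
    have := ENNReal.tendsto_ofReal h
    rwa [zero_add, ha, ENNReal.ofReal_toReal hα'] at this
  rw [← hlim.limsup_eq]
  refine limsup_le_limsup ?_
  filter_upwards [Ioo_mem_nhdsGT (zero_lt_one (α := ℝ))] with ε ⟨hε0, hε1⟩
  refine ENNReal.ofReal_le_ofReal ?_
  have hlog : 0 < Real.log (1 / ε) := Real.log_pos (by rwa [lt_div_iff₀ hε0, one_mul])
  have hinv1 : 1 ≤ (1 / ε) ^ a :=
    Real.one_le_rpow (by rw [le_div_iff₀ hε0]; linarith) ha0.le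
  have hle : (SX X ε : ℝ) ≤ (C ^ a + 1) * (1 / ε) ^ a := by
    have h₁ : (SX X ε : ℝ) ≤ (⌈(C / ε) ^ a⌉₊ : ℝ) := by
      exact_mod_cast SX_le_of_holder hf hC ha0 hfC hε0
    have h₂ := (Nat.ceil_lt_add_one (by positivity : 0 ≤ (C / ε) ^ a)).le
    have h₃ : (C / ε) ^ a = C ^ a * (1 / ε) ^ a := by
      rw [← Real.mul_rpow hC.le (by positivity), mul_one_div]
    rw [h₃] at h₁ h₂
    linarith
  have hlogle : Real.log (SX X ε) ≤ Real.log (C ^ a + 1) + a * Real.log (1 / ε) := by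
    rw [← Real.log_rpow (by positivity), ← Real.log_mul (by positivity) (by positivity)]
    rcases Nat.eq_zero_or_pos (SX X ε) with h0 | h0
    · rw [h0, Nat.cast_zero, Real.log_zero]
      have : 0 ≤ C ^ a := by positivity
      exact Real.log_nonneg (by nlinarith)
    · exact Real.log_le_log (by exact_mod_cast h0) hle
  rw [div_add' _ _ _ hlog.ne']
  gcongr

theorem exists_SX_le_of_SDim_lt {X : Type*} [MetricSpace X] {t : ℝ} (ht : 0 ≤ t)
    (h : SDim X < ENNReal.ofReal t) :
    ∃ c : ℝ, 1 ≤ c ∧ ∀ m : ℕ, (SX X ((1 / 2) ^ m) : ℝ) ≤ c * ((2 : ℝ) ^ t) ^ m := by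
  have hev := eventually_lt_of_limsup_lt h
  have hlim : Tendsto (fun m : ℕ => (1 / 2 : ℝ) ^ m) atTop (𝓝[>] 0) :=
    tendsto_nhdsWithin_iff.2 ⟨tendsto_pow_atTop_nhds_zero_of_lt_one (by norm_num) (by norm_num),
      Eventually.of_forall fun m => mem_Ioi.2 (by positivity)⟩
  obtain ⟨m₀, hm₀⟩ := eventually_atTop.1 (hlim.eventually hev)
  have h2t : 1 ≤ (2 : ℝ) ^ t := Real.one_le_rpow one_le_two ht
  have hsum : 0 ≤ ∑ k ∈ Finset.range (m₀ + 1), (SX X ((1 / 2) ^ k) : ℝ) :=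
    Finset.sum_nonneg fun _ _ => Nat.cast_nonneg _
  refine ⟨1 + ∑ k ∈ Finset.range (m₀ + 1), (SX X ((1 / 2) ^ k) : ℝ), by linarith, fun m => ?_⟩
  have hpow : 1 ≤ ((2 : ℝ) ^ t) ^ m := one_le_pow₀ h2t
  rcases le_or_gt m m₀ with hm | hm
  · have := Finset.single_le_sum (f := fun k : ℕ => (SX X ((1 / 2) ^ k) : ℝ))
      (fun _ _ => Nat.cast_nonneg _) (Finset.mem_range.2 (Nat.lt_succ_of_le hm))
    nlinarith
  · suffices hS : (SX X ((1 / 2) ^ m) : ℝ) ≤ ((2 : ℝ) ^ t) ^ m by nlinarith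
    rcases Nat.eq_zero_or_pos (SX X ((1 / 2) ^ m)) with h0 | h0
    · rw [h0]
      simp only [Nat.cast_zero]
      linarith
    · have h₁ := (ENNReal.ofReal_lt_ofReal_iff_of_nonneg ?_).1 (hm₀ m hm.le)
      · have hlog : Real.log (1 / (1 / 2 : ℝ) ^ m) = m * Real.log 2 := by
          rw [← Real.log_pow]
          congr 1
          simp
        have hm0 : (0 : ℝ) < m := by exact_mod_cast (by omega : 0 < m)
        rw [hlog, div_lt_iff₀ (mul_pos hm0 (Real.log_pos one_lt_two))] at h₁
        rw [← Real.log_le_log_iff (by exact_mod_cast h0) (by positivity), Real.log_pow,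
          Real.log_rpow two_pos]
        linarith
      · refine div_nonneg (Real.log_natCast_nonneg _) (Real.log_nonneg ?_)
        rw [le_div_iff₀ (by positivity), one_mul]
        exact pow_le_one₀ (by norm_num) (by norm_num)

theorem HoDim_le_two_mul_SDim (X : Type*) [MetricSpace X] [CompactSpace X] [ConnectedSpace X]
    [LocallyConnectedSpace X] : HoDim X ≤ 2 * SDim X := by
  classical
  refine le_of_forall_gt_imp_ge_of_dense fun α hα => ?_
  rcases eq_or_ne α ⊤ with rfl | hα'
  · exact le_top
  have hα0 : 0 < α := (zero_le).trans_lt hα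
  have hlt : SDim X < α / 2 := by
    rwa [ENNReal.lt_div_iff_mul_lt (by simp) (by simp), mul_comm]
  obtain ⟨t, hSt, htα⟩ := exists_between hlt
  have ht' : t ≠ ⊤ := htα.ne_top
  have ha0 : 0 < α.toReal := ENNReal.toReal_pos hα0.ne' hα'
  have hta : 2 * t.toReal < α.toReal := by
    have h : t * 2 < α := by
      rwa [ENNReal.lt_div_iff_mul_lt (by simp) (by simp)] at htα
    have := ENNReal.toReal_strict_mono hα' h
    rw [ENNReal.toReal_mul] at this
    simpa [mul_comm] using this
  obtain ⟨c, hc, hcS⟩ := exists_SX_le_of_SDim_lt (X := X) (t := t.toReal) ENNReal.toReal_nonneg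
    (by rwa [ENNReal.ofReal_toReal ht'])
  choose 𝒟 h𝒟card h𝒟 h𝒟cov using fun m : ℕ =>
    exists_finset_card_eq_SX X (show (0 : ℝ) < (1 / 2) ^ m by positivity)
  let 𝒞 : ℕ → Finset (Set X) := fun m => if m = 0 then {univ} else (𝒟 m).image closure
  have h𝒞0 : 𝒞 0 = {univ} := rfl
  have h𝒞 : ∀ m, m ≠ 0 → 𝒞 m = (𝒟 m).image closure := fun m hm => if_neg hm
  have hcov : IsGeometricCovering 𝒞 (diam (univ : Set X) + 1) := by
    constructor
    · exact h𝒞0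
    · intro m S hS
      rcases eq_or_ne m 0 with rfl | hm
      · rw [h𝒞0, Finset.mem_singleton] at hS
        subst hS
        exact isConnected_univ
      · rw [h𝒞 m hm] at hS
        obtain ⟨A, hA, rfl⟩ := Finset.mem_image.1 hS
        exact (h𝒟 m A hA).1.closure
    · intro m S hS
      rcases eq_or_ne m 0 with rfl | hm
      · rw [h𝒞0, Finset.mem_singleton] at hS
        subst hS
        exact isClosed_univ
      · rw [h𝒞 m hm] at hS
        obtain ⟨_, _, rfl⟩ := Finset.mem_image.1 hS
        exact isClosed_closure
    · intro m S hS x hx y hy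
      rcases eq_or_ne m 0 with rfl | hm
      · have := dist_le_diam_of_mem isCompact_univ.isBounded (mem_univ x) (mem_univ y)
        rw [pow_zero, mul_one]
        linarith
      · rw [h𝒞 m hm] at hS
        obtain ⟨A, hA, rfl⟩ := Finset.mem_image.1 hS
        have h₁ := dist_le_diam_of_mem isClosed_closure.isCompact.isBounded hx hy
        rw [diam_closure] at h₁
        have h₂ := (h𝒟 m A hA).2
        have h₃ : 0 ≤ diam (univ : Set X) * (1 / 2) ^ m := mul_nonneg diam_nonneg (by positivity)
        linarith
    · intro m
      rcases eq_or_ne m 0 with rfl | hm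
      · simp [h𝒞0]
      · refine eq_univ_of_forall fun x => ?_
        obtain ⟨S, hS, hxS⟩ :=
          mem_sUnion.1 (h𝒟cov m ▸ mem_univ x : x ∈ ⋃₀ (𝒟 m : Set (Set X)))
        rw [h𝒞 m hm]
        exact mem_sUnion.2 ⟨_, Finset.mem_coe.2 (Finset.mem_image_of_mem _ hS), subset_closure hxS⟩
  have hcard : ∀ m, ((𝒞 m).card : ℝ) ≤ c * ((2 : ℝ) ^ t.toReal) ^ m := by
    intro m
    rcases eq_or_ne m 0 with rfl | hm
    · simpa [h𝒞0] using hc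
    · refine le_trans ?_ (hcS m)
      rw [h𝒞 m hm, ← h𝒟card m]
      exact_mod_cast Finset.card_image_le
  obtain ⟨f, hf, C, hC, hfC⟩ := hcov.exists_holder_surjection
    (add_pos_of_nonneg_of_pos diam_nonneg one_pos) ha0 hta (by linarith) hcard
  refine sInf_le ⟨hα0, f, hf, C, hC, fun x _ y _ => ?_⟩
  rw [ENNReal.toReal_inv, ← one_div]
  exact hfC x y

/-- For every metric Peano continuum, `S-Dim(X) ≤ HöDim(X) ≤ 2·S-Dim(X)`. -/
theorem sdim_le_hodim_le_two_sdim (X : Type*) [MetricSpace X] [CompactSpace X]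
    [ConnectedSpace X] [LocallyConnectedSpace X] [Nonempty X] :
    SDim X ≤ HoDim X ∧ HoDim X ≤ 2 * SDim X :=
  ⟨SDim_le_HoDim X, HoDim_le_two_mul_SDim X⟩
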